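/- Let ν > 0, m ≥ 1, n ≥ 1 and 0 ≤ θ ≤ ν/2. Let v : ℝ^d → ℝ^d be continuously differentiable with compact support and suppose: (i) the error inequality ν ∫_{Ω_F} |∇v|² dx + νm ∫_{Ω_S} |∇v|² dx + n ∫_{Ω_S} |v|² dx ≤ ∫_{Ω_S} f·v dx + ∫_Σ |g·v| d𝓗^{d−1} + θ ∫_Ω |∇v|² dx holds; (ii) the Poincaré inequality ∫_{Ω_S} |v|² dx ≤ C_P ∫_{Ω_S} |∇v|² dx holds for some C_P ≥ 0; (iii) the interpolation trace inequality ∫_Σ |v|² d𝓗^{d−1} ≤ C_T · (∫_{Ω_S} |∇v|² dx)^{1/2} · (∫_{Ω_S} |v|² dx)^{1/2} holds for some C_T ≥ 0. Then there is a constant C depending only on ν, C_P, C_T, ∫_{Ω_S} |f|² dx and ∫_Σ |g|² d𝓗^{d−1} (but not on m or n) such that (∫_{Ω_S} |v|² dx)^{1/2} ≤ C · (νm)^{-1/4} · n^{-3/4}. (This is estimate (mix:4) of Theorem 3, with v playing the role of u_{m,n} on the obstacle and θ the absorbed convective contribution under the smallness assumption on f.) -/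

import Mathlib

open MeasureTheory
open scoped RealInnerProductSpace

noncomputable section

/-- `|∇v|²(x) = ∑_{i,j} (∂_j v_i(x))²`. -/
def gradSq {d : ℕ} (v : EuclideanSpace ℝ (Fin d) → EuclideanSpace ℝ (Fin d))
    (x : EuclideanSpace ℝ (Fin d)) : ℝ :=
  ∑ j : Fin d, ‖fderiv ℝ v x (EuclideanSpace.single j 1)‖ ^ 2

/-- Cauchy–Schwarz for the integral of `|⟪f, v⟫|`, assuming only that the squared norms are
integrable (neither field needs to be measurable). -/
theorem integral_abs_inner_le_sqrt_mul_sqrt {α E : Type*} [MeasurableSpace α]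
    [NormedAddCommGroup E] [InnerProductSpace ℝ E] {μ : Measure α} {f v : α → E}
    (hf : Integrable (fun x => ‖f x‖ ^ 2) μ) (hv : Integrable (fun x => ‖v x‖ ^ 2) μ) :
    ∫ x, |⟪f x, v x⟫| ∂μ ≤ √(∫ x, ‖f x‖ ^ 2 ∂μ) * √(∫ x, ‖v x‖ ^ 2 ∂μ) := by
  have memLp_norm {w : α → E} (hw : Integrable (fun x => ‖w x‖ ^ 2) μ) :
      MemLp (fun x => ‖w x‖) 2 μ := by
    have hm : AEStronglyMeasurable (fun x => ‖w x‖) μ := by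
      simpa using Real.continuous_sqrt.comp_aestronglyMeasurable hw.aestronglyMeasurable
    exact (memLp_two_iff_integrable_sq hm).2 hw
  have hint : Integrable (fun x => ‖f x‖ * ‖v x‖) μ :=
    (memLp_norm hf).integrable_mul (memLp_norm hv)
  calc ∫ x, |⟪f x, v x⟫| ∂μ ≤ ∫ x, ‖f x‖ * ‖v x‖ ∂μ :=
        integral_mono_of_nonneg (ae_of_all _ fun _ => abs_nonneg _) hint
          (ae_of_all _ fun x => abs_real_inner_le_norm (f x) (v x))
    _ ≤ _ := by
        have h := integral_mul_le_Lp_mul_Lq_of_nonneg (μ := μ) Real.HolderConjugate.two_two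
          (ae_of_all _ fun x => norm_nonneg (f x)) (ae_of_all _ fun x => norm_nonneg (v x))
          (by simpa using memLp_norm hf) (by simpa using memLp_norm hv)
        simpa [Real.sqrt_eq_rpow] using h

theorem gradSq_nonneg {d : ℕ} (v : EuclideanSpace ℝ (Fin d) → EuclideanSpace ℝ (Fin d))
    (x : EuclideanSpace ℝ (Fin d)) : 0 ≤ gradSq v x :=
  Finset.sum_nonneg fun _ _ => by positivity

theorem integrable_gradSq {d : ℕ} {v : EuclideanSpace ℝ (Fin d) → EuclideanSpace ℝ (Fin d)}
    (hv : ContDiff ℝ 1 v) (hc : HasCompactSupport v) : Integrable (gradSq v) := by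
  have hcont : Continuous (fderiv ℝ v) := hv.continuous_fderiv one_ne_zero
  refine Continuous.integrable_of_hasCompactSupport ?_ ?_
  · unfold gradSq
    fun_prop
  · refine (hc.fderiv (𝕜 := ℝ)).mono fun x hx h => hx ?_
    simp [gradSq, h]

/-- A continuous compactly supported field is square integrable for any finite measure. -/
theorem integrable_norm_sq_of_hasCompactSupport {X E : Type*} [TopologicalSpace X]
    [MeasurableSpace X] [OpensMeasurableSpace X] [NormedAddCommGroup E] {μ : Measure X}
    [IsFiniteMeasure μ] {v : X → E} (hv : Continuous v) (hc : HasCompactSupport v) :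
    Integrable (fun x => ‖v x‖ ^ 2) μ := by
  refine Continuous.integrable_of_hasCompactSupport (by fun_prop) ?_
  exact hc.mono fun x hx h => hx (by simp [h])

/-- If `a⁴/2 · y² + b⁴ x² ≤ K √(xy)`, then `x ≤ K a⁻¹ b⁻³`, in multiplied-out form. -/
theorem mul_le_of_quadratic_le_mul_sqrt {a b x y s K : ℝ} (hK : 0 ≤ K) (hs : 0 ≤ s)
    (hxy : s ^ 2 = x * y) (h : a ^ 4 / 2 * y ^ 2 + b ^ 4 * x ^ 2 ≤ K * s) :
    x * (a * b ^ 3) ≤ K := by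
  have hamgm : (a * b) ^ 2 * s * s ≤ K * s := by
    have h1 : (a * b) ^ 2 * s * s = a ^ 2 * b ^ 2 * (x * y) := by rw [← hxy]; ring
    nlinarith [sq_nonneg (a ^ 2 * y - b ^ 2 * x), sq_nonneg (b ^ 2 * x)]
  have hle : (a * b) ^ 2 * s ≤ K := by
    rcases hs.eq_or_lt with rfl | hs
    · simpa using hK
    · exact le_of_mul_le_mul_right hamgm hs
  refine le_of_sq_le_sq ?_ hK
  calc (x * (a * b ^ 3)) ^ 2 = (a * b) ^ 2 * (b ^ 4 * x ^ 2) := by ring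
    _ ≤ (a * b) ^ 2 * (K * s) := by
        refine mul_le_mul_of_nonneg_left (le_trans ?_ h) (sq_nonneg _)
        exact le_add_of_nonneg_left (by positivity)
    _ = K * ((a * b) ^ 2 * s) := by ring
    _ ≤ K * K := by gcongr
    _ = K ^ 2 := by ring

/-- The scalar core of the obstacle estimate: `V` and `G` are the squared `L²` norms of the field
and of its gradient, `M` and `n` the two penalization weights. -/
theorem sqrt_le_of_penalized_energy_le {M n V G P T A B : ℝ} (hM : 0 < M) (hn : 0 < n)
    (hV : 0 ≤ V) (hG : 0 ≤ G) (hA : 0 ≤ A) (hB : 0 ≤ B) (hVG : V ≤ P * G) (hP : 0 ≤ P)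
    (hT : 0 ≤ T) (h : M / 2 * G + n * V ≤ A * √V + B * √(T * √G * √V)) :
    √V ≤ (A * √(√P) + B * √T) * (M ^ (-(1/4) : ℝ) * n ^ (-(3/4) : ℝ)) := by
  have hM4 : (M ^ (1/4 : ℝ)) ^ 4 = M := by
    rw [← Real.rpow_mul_natCast hM.le]; norm_num
  have hn4 : (n ^ (1/4 : ℝ)) ^ 4 = n := by
    rw [← Real.rpow_mul_natCast hn.le]; norm_num
  have hn3 : (n ^ (1/4 : ℝ)) ^ 3 = n ^ (3/4 : ℝ) := by
    rw [← Real.rpow_mul_natCast hn.le]; norm_num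
  have hV_le : √V ≤ √(√P) * √(√V * √G) := by
    rw [← Real.sqrt_mul (Real.sqrt_nonneg _)]
    refine Real.le_sqrt_of_sq_le ?_
    calc √V ^ 2 = √V * √V := sq _
      _ ≤ √V * √(P * G) := by gcongr
      _ = √P * (√V * √G) := by rw [Real.sqrt_mul hP]; ring
  have hsplit : √(T * √G * √V) = √T * √(√V * √G) := by
    rw [← Real.sqrt_mul hT]; congr 1; ring
  have key := mul_le_of_quadratic_le_mul_sqrt (a := M ^ (1/4 : ℝ)) (b := n ^ (1/4 : ℝ))
    (x := √V) (y := √G) (s := √(√V * √G)) (K := A * √(√P) + B * √T)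
    (by positivity) (Real.sqrt_nonneg _) (Real.sq_sqrt (by positivity)) (by
      rw [hM4, hn4, Real.sq_sqrt hV, Real.sq_sqrt hG]
      rw [hsplit] at h
      nlinarith [mul_le_mul_of_nonneg_left hV_le hA])
  rw [hn3] at key
  rw [Real.rpow_neg hM.le, Real.rpow_neg hn.le, ← mul_inv, ← div_eq_mul_inv,
    le_div_iff₀ (by positivity)]
  exact key

/-- Estimate (mix:4) of Theorem 3: under the error inequality, the Poincaré
inequality on the obstacle and the interpolation trace inequality, the
`L²`-norm of `v = u_{m,n}` on the obstacle is `O((νm)^{-1/4} n^{-3/4})`,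
with a constant depending only on `ν`, `C_P`, `C_T`, `∫_{Ω_S} |f|²` and
`∫_Σ |g|²` (but not on `m` or `n`). -/
theorem mixed_penalization_obstacle_L2_estimate
    (d : ℕ) (hd : 1 ≤ d) :
    ∃ C : ℝ → ℝ → ℝ → ℝ → ℝ → ℝ,
      ∀ (Ω ΩS Sig : Set (EuclideanSpace ℝ (Fin d))),
        IsOpen Ω → Bornology.IsBounded Ω → MeasurableSet ΩS → ΩS ⊆ Ω →
        MeasurableSet Sig → μH[(d : ℝ) - 1] Sig < ⊤ →
      ∀ (f g v : EuclideanSpace ℝ (Fin d) → EuclideanSpace ℝ (Fin d)),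
        IntegrableOn (fun x => ‖f x‖ ^ 2) ΩS →
        Integrable (fun x => ‖g x‖ ^ 2) (μH[(d : ℝ) - 1].restrict Sig) →
        ContDiff ℝ 1 v → HasCompactSupport v →
      ∀ (ν m n θ C_P C_T : ℝ),
        0 < ν → 1 ≤ m → 1 ≤ n → 0 ≤ θ → θ ≤ ν / 2 → 0 ≤ C_P → 0 ≤ C_T →
        (ν * ∫ x in Ω \ ΩS, gradSq v x) + (ν * m * ∫ x in ΩS, gradSq v x)
            + (n * ∫ x in ΩS, ‖v x‖ ^ 2)
          ≤ (∫ x in ΩS, ⟪f x, v x⟫)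
            + (∫ x in Sig, |⟪g x, v x⟫| ∂μH[(d : ℝ) - 1])
            + θ * ∫ x in Ω, gradSq v x →
        (∫ x in ΩS, ‖v x‖ ^ 2) ≤ C_P * ∫ x in ΩS, gradSq v x →
        (∫ x in Sig, ‖v x‖ ^ 2 ∂μH[(d : ℝ) - 1])
          ≤ C_T * Real.sqrt (∫ x in ΩS, gradSq v x)
              * Real.sqrt (∫ x in ΩS, ‖v x‖ ^ 2) →
        Real.sqrt (∫ x in ΩS, ‖v x‖ ^ 2)
          ≤ C ν C_P C_T (∫ x in ΩS, ‖f x‖ ^ 2)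
              (∫ x in Sig, ‖g x‖ ^ 2 ∂μH[(d : ℝ) - 1])
            * ((ν * m) ^ (-(1/4) : ℝ) * n ^ (-(3/4) : ℝ)) := by
  refine ⟨fun _ C_P C_T F H => √F * √(√C_P) + √H * √C_T, ?_⟩
  intro Ω ΩS Sig hΩ hΩb hΩS hsub hSig hSigfin f g v hf hg hv hvc ν m n θ C_P C_T hν hm hn hθ0 hθ
    hCP hCT henergy hpoinc htrace
  have : IsFiniteMeasure (volume.restrict ΩS) :=
    ⟨by simpa using (hΩb.subset hsub).measure_lt_top⟩
  have : IsFiniteMeasure (μH[(d : ℝ) - 1].restrict Sig) := ⟨by simpa using hSigfin⟩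
  have hgrad := integrable_gradSq hv hvc
  have hsplit : ∫ x in Ω, gradSq v x
      = (∫ x in Ω \ ΩS, gradSq v x) + ∫ x in ΩS, gradSq v x := by
    rw [setIntegral_sdiff hΩS hgrad.integrableOn hsub]
    ring
  have hA : 0 ≤ ∫ x in Ω \ ΩS, gradSq v x := integral_nonneg fun x => gradSq_nonneg v x
  have hG : 0 ≤ ∫ x in ΩS, gradSq v x := integral_nonneg fun x => gradSq_nonneg v x
  have hV : 0 ≤ ∫ x in ΩS, ‖v x‖ ^ 2 := integral_nonneg fun x => by positivity
  have hfv : ∫ x in ΩS, ⟪f x, v x⟫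
      ≤ √(∫ x in ΩS, ‖f x‖ ^ 2) * √(∫ x in ΩS, ‖v x‖ ^ 2) :=
    (le_abs_self _).trans <| abs_integral_le_integral_abs.trans <|
      integral_abs_inner_le_sqrt_mul_sqrt hf
        (integrable_norm_sq_of_hasCompactSupport hv.continuous hvc)
  have hgv := (integral_abs_inner_le_sqrt_mul_sqrt hg
    (integrable_norm_sq_of_hasCompactSupport hv.continuous hvc)).trans
      (mul_le_mul_of_nonneg_left (Real.sqrt_le_sqrt htrace) (Real.sqrt_nonneg _))
  refine sqrt_le_of_penalized_energy_le (by positivity) (by positivity) hV hG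
    (Real.sqrt_nonneg _) (Real.sqrt_nonneg _) hpoinc hCP hCT ?_
  rw [hsplit] at henergy
  have hθA := mul_le_mul_of_nonneg_right hθ (add_nonneg hA hG)
  have hνA := mul_nonneg hν.le hA
  have hmG := mul_nonneg (mul_nonneg hν.le (sub_nonneg.2 hm)) hG
  linarith
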